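/- Let G be a finite group, N a normal subgroup of G, and θ an irreducible finite-dimensional complex representation of N with α(θ) = 1. Then α(θ^G) = 1, where θ^G is the representation of G induced from θ. -/

import Mathlib

namespace AlphaChar

variable {G : Type*} [Group G] {V : Type*} [AddCommMonoid V] [Module ℂ V]

/-- The cardinality of the orbit of a vector `v` under the linear action of `G` via `ρ`. -/
noncomputable def orbitCard (ρ : Representation ℂ G V) (v : V) : ℕ :=
  Nat.card (Set.range fun g : G => ρ g v)

open Classical in
/-- The α-characteristic of a representation: the gcd of the cardinalities of the orbits
of all nonzero vectors. -/
noncomputable def alphaChar [Finite G] (ρ : Representation ℂ G V) : ℕ :=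
  ((Finset.range (Nat.card G + 1)).filter
    (fun n => ∃ v : V, v ≠ 0 ∧ orbitCard ρ v = n)).gcd id

/-- A representation is nontrivial if some group element acts as a non-identity operator. -/
def IsNontrivial (ρ : Representation ℂ G V) : Prop := ∃ g : G, ρ g ≠ 1

/-- A representation is irreducible if the space is nonzero and the only invariant
subspaces are `⊥` and `⊤`. -/
def IsIrreducible (ρ : Representation ℂ G V) : Prop :=
  Nontrivial V ∧
    ∀ U : Submodule ℂ V, (∀ (g : G) (v : V), v ∈ U → ρ g v ∈ U) → U = ⊥ ∨ U = ⊤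

end AlphaChar

namespace AlphaChar

variable {G : Type*} [Group G] (N : Subgroup G)
variable {W : Type*} [AddCommGroup W] [Module ℂ W]

/-- The space of the representation of `G` induced from a representation `θ` of a
subgroup `N`: functions `f : G → W` with `f (g * n) = θ n⁻¹ (f g)` (for finite groups
this coinduction model realizes the induced representation). -/
def inducedSpace (θ : Representation ℂ ↥N W) : Submodule ℂ (G → W) where
  carrier := {f | ∀ (g : G) (n : ↥N), f (g * n) = θ n⁻¹ (f g)}
  zero_mem' := by intro g n; simp
  add_mem' := by
    intro a b ha hb g n
    simp only [Pi.add_apply, ha g n, hb g n, map_add]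
  smul_mem' := by
    intro c f hf g n
    simp only [Pi.smul_apply, hf g n, map_smul]

/-- The representation of `G` induced from the representation `θ` of the subgroup `N`,
given by `(g · f) x = f (g⁻¹ * x)` on `inducedSpace N θ`. -/
def inducedRep (θ : Representation ℂ ↥N W) : Representation ℂ G ↥(inducedSpace N θ) where
  toFun g :=
    { toFun := fun f => ⟨fun x => f.1 (g⁻¹ * x), by
        intro x n
        have := f.2 (g⁻¹ * x) n
        simpa [mul_assoc] using this⟩
      map_add' := by intro f₁ f₂; ext x; rfl
      map_smul' := by intro c f; ext x; rfl }
  map_one' := by ext f x; simp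
  map_mul' := by
    intro a b
    ext f x
    simp [mul_assoc]

end AlphaChar

namespace AlphaChar

/-- The stabilizer of a vector under a representation. -/
def vectorStabilizer {G : Type*} [Group G] {V : Type*} [AddCommMonoid V] [Module ℂ V]
    (ρ : Representation ℂ G V) (v : V) : Subgroup G where
  carrier := {g | ρ g v = v}
  one_mem' := by simp
  mul_mem' := by
    intro a b ha hb
    simp only [Set.mem_ofPred_eq] at ha hb
    simp [ha, hb]
  inv_mem' := by
    intro a ha
    simp only [Set.mem_ofPred_eq] at ha
    have h := ρ.inv_self_apply a v
    rw [ha] at h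
    exact h

theorem mem_vectorStabilizer {G : Type*} [Group G] {V : Type*} [AddCommMonoid V] [Module ℂ V]
    {ρ : Representation ℂ G V} {v : V} {g : G} : g ∈ vectorStabilizer ρ v ↔ ρ g v = v :=
  Iff.rfl

theorem orbitCard_eq_index {G : Type*} [Group G] {V : Type*} [AddCommMonoid V] [Module ℂ V]
    (ρ : Representation ℂ G V) (v : V) : orbitCard ρ v = (vectorStabilizer ρ v).index := by
  let _ : MulAction G V := MulAction.compHom V ρ
  have h : MulAction.stabilizer G v = vectorStabilizer ρ v := by
    ext g
    exact Iff.rfl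
  rw [← h, MulAction.index_stabilizer]
  rfl

theorem alphaChar_dvd_orbitCard {G : Type*} [Group G] [Finite G] {V : Type*} [AddCommMonoid V]
    [Module ℂ V] (ρ : Representation ℂ G V) {v : V} (hv : v ≠ 0) :
    alphaChar ρ ∣ orbitCard ρ v := by
  classical
  refine Finset.gcd_dvd (f := id) (Finset.mem_filter.2 ⟨Finset.mem_range.2 ?_, v, hv, rfl⟩)
  change orbitCard ρ v < _
  rw [orbitCard_eq_index]
  exact Nat.lt_succ_of_le (Nat.le_of_dvd Nat.card_pos (Subgroup.index_dvd_card _))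

theorem dvd_alphaChar {G : Type*} [Group G] [Finite G] {V : Type*} [AddCommMonoid V]
    [Module ℂ V] (ρ : Representation ℂ G V) {d : ℕ} (h : ∀ v : V, v ≠ 0 → d ∣ orbitCard ρ v) :
    d ∣ alphaChar ρ := by
  classical
  refine Finset.dvd_gcd fun n hn => ?_
  obtain ⟨-, v, hv, rfl⟩ := Finset.mem_filter.1 hn
  exact h v hv

theorem alphaChar_eq_one_iff {G : Type*} [Group G] [Finite G] {V : Type*} [AddCommMonoid V]
    [Module ℂ V] (ρ : Representation ℂ G V) :
    alphaChar ρ = 1 ↔ ∀ p : ℕ, p.Prime → ∃ v : V, v ≠ 0 ∧ ¬ p ∣ orbitCard ρ v := by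
  rw [Nat.eq_one_iff_not_exists_prime_dvd]
  refine forall₂_congr fun p _ => ⟨fun h => ?_, ?_⟩
  · by_contra! hc
    exact h (dvd_alphaChar ρ hc)
  · rintro ⟨v, hv, hpv⟩ hp
    exact hpv (hp.trans (alphaChar_dvd_orbitCard ρ hv))

/-- A subgroup of index prime to `p` contains a Sylow `p`-subgroup of the whole group. -/
theorem exists_sylow_le_of_not_dvd_index {G : Type*} [Group G] [Finite G] {p : ℕ}
    [Fact p.Prime] (S : Subgroup G) (hS : ¬ p ∣ S.index) : ∃ Q : Sylow p G, ↑Q ≤ S := by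
  obtain ⟨R⟩ : Nonempty (Sylow p S) := inferInstance
  have hR : ¬ p ∣ ((R : Subgroup S).map S.subtype).index := by
    rw [Subgroup.index_map_subtype, (Fact.out : p.Prime).dvd_mul]
    exact not_or.2 ⟨R.not_dvd_index, hS⟩
  exact ⟨(R.isPGroup'.map S.subtype).toSylow hR, Subgroup.map_subtype_le _⟩

/-- If `v` is fixed by `P ∩ N`, there is a `P`-fixed vector of the induced representation
taking the value `v` at `1`. -/
theorem exists_fixed_inducedSpace {G : Type*} [Group G] (N P : Subgroup G) {W : Type*}
    [AddCommGroup W] [Module ℂ W] (θ : Representation ℂ ↥N W) (v : W)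
    (hv : ∀ n : ↥N, (n : G) ∈ P → θ n v = v) :
    ∃ f : inducedSpace N θ, f.1 1 = v ∧ ∀ g ∈ P, inducedRep N θ g f = f := by
  classical
  let F : G → W := fun y => if h : ∃ n : ↥N, y * n ∈ P then θ h.choose v else 0
  have hF : ∀ (y : G) (n : ↥N), y * n ∈ P → F y = θ n v := by
    intro y n hn
    have h : ∃ n : ↥N, y * n ∈ P := ⟨n, hn⟩
    simp only [F, dif_pos h]
    have hmem : ((n⁻¹ * h.choose : ↥N) : G) ∈ P := by
      simpa [mul_assoc] using P.mul_mem (P.inv_mem hn) h.choose_spec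
    have key := hv _ hmem
    calc θ h.choose v = θ (n * (n⁻¹ * h.choose)) v := by rw [mul_inv_cancel_left]
      _ = θ n v := by rw [map_mul, Module.End.mul_apply, key]
  have hF0 : ∀ y : G, (¬ ∃ n : ↥N, y * n ∈ P) → F y = 0 := fun y hy => dif_neg hy
  refine ⟨⟨F, fun g n => ?_⟩, ?_, fun x hx => ?_⟩
  · by_cases h : ∃ m : ↥N, g * m ∈ P
    · obtain ⟨m, hm⟩ := h
      rw [hF g m hm, hF (g * n) (n⁻¹ * m) (by simpa [mul_assoc] using hm), map_mul,
        Module.End.mul_apply]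
    · rw [hF0 g h, map_zero]
      refine hF0 _ ?_
      rintro ⟨m, hm⟩
      exact h ⟨n * m, by simpa [mul_assoc] using hm⟩
  · simpa using hF 1 1 (by simp)
  · refine Subtype.ext (funext fun y => ?_)
    change F (x⁻¹ * y) = F y
    have hxy : ∀ n : ↥N, x⁻¹ * y * n ∈ P ↔ y * n ∈ P := fun n => by
      rw [mul_assoc, P.mul_mem_cancel_left (P.inv_mem hx)]
    by_cases h : ∃ m : ↥N, y * m ∈ P
    · obtain ⟨m, hm⟩ := h
      rw [hF y m hm, hF _ m ((hxy m).2 hm)]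
    · rw [hF0 y h, hF0 _ fun ⟨m, hm⟩ => h ⟨m, (hxy m).1 hm⟩]

/-- Induction from an arbitrary subgroup preserves the property of having a nonzero vector
whose orbit has cardinality prime to `p`. -/
theorem exists_not_dvd_orbitCard_inducedRep {G : Type*} [Group G] [Finite G] (N : Subgroup G)
    {W : Type*} [AddCommGroup W] [Module ℂ W] (θ : Representation ℂ ↥N W) {p : ℕ}
    [Fact p.Prime] {v : W} (hv : v ≠ 0) (hpv : ¬ p ∣ orbitCard θ v) :
    ∃ f : inducedSpace N θ, f ≠ 0 ∧ ¬ p ∣ orbitCard (inducedRep N θ) f := by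
  rw [orbitCard_eq_index] at hpv
  obtain ⟨Q, hQ⟩ := exists_sylow_le_of_not_dvd_index _ hpv
  obtain ⟨P, hP⟩ := (Q.isPGroup'.map N.subtype).exists_le_sylow
  have hPQ : (P : Subgroup G).subgroupOf N = Q :=
    Q.is_maximal' (P.isPGroup'.comap_subtype) (Subgroup.map_le_iff_le_comap.1 hP)
  obtain ⟨f, hf1, hfP⟩ := exists_fixed_inducedSpace N P θ v fun n hn =>
    mem_vectorStabilizer.1 (hQ (hPQ ▸ Subgroup.mem_subgroupOf.2 hn))
  refine ⟨f, ?_, fun hp => P.not_dvd_index (hp.trans ?_)⟩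
  · rintro rfl
    exact hv hf1.symm
  · rw [orbitCard_eq_index]
    exact Subgroup.index_dvd_of_le hfP

end AlphaChar

open AlphaChar in
/-- if N is normal and θ is an irreducible N-representation with
α(θ) = 1, then α(θ^G) = 1. -/
theorem alphaChar_induced_eq_one {G : Type} [Group G] [Finite G]
    (N : Subgroup G) [N.Normal] {W : Type} [AddCommGroup W] [Module ℂ W]
    [FiniteDimensional ℂ W] (θ : Representation ℂ ↥N W)
    (hirr : IsIrreducible θ) (hθ : alphaChar θ = 1) :
    alphaChar (inducedRep N θ) = 1 := by
  rw [alphaChar_eq_one_iff] at hθ ⊢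
  intro p hp
  obtain ⟨v, hv, hpv⟩ := hθ p hp
  have : Fact p.Prime := ⟨hp⟩
  exact exists_not_dvd_orbitCard_inducedRep N θ hv hpv
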